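/- arXiv:2504.12866 — 3 statements merged into one kernel-verified Lean document; each statement's English description precedes it below -/
import Mathlib

section
/- Let μ_I be the uniform probability measure on [0,1] and let ν be the uniform probability measure on [0,2π). Then for every r with 0 ≤ r ≤ 1, the measure of the set {(t₁,t₂,θ₁,θ₂) : D(t₁,t₂,θ₁,θ₂) ≤ r} with respect to μ_I ⊗ μ_I ⊗ ν ⊗ ν equals r²/2. -/
open MeasureTheory Real

/-- Distance from the origin to the intersection point of the lines
`{(x,y) : x cos θᵢ + y sin θᵢ = tᵢ}`, `i = 1, 2`. -/
noncomputable def interDist (t₁ t₂ θ₁ θ₂ : ℝ) : ℝ :=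
  Real.sqrt (t₁ ^ 2 + t₂ ^ 2 - 2 * t₁ * t₂ * Real.cos (θ₂ - θ₁)) / |Real.sin (θ₂ - θ₁)|

/-- Uniform probability measure on `[0, 2π)`. -/
noncomputable def unifCircle : Measure ℝ :=
  (ENNReal.ofReal (2 * π))⁻¹ • volume.restrict (Set.Ico 0 (2 * π))

/-- Uniform probability measure on `[0, 1]` (Bertrand's "uniform radius" chord). -/
noncomputable def unifRadius : Measure ℝ := volume.restrict (Set.Icc 0 1)

/-- The ellipse cut out in the `(t₁, t₂)`-plane by the condition that two lines at angle `δ`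
meet at distance at most `r` from the origin. -/
def chordEllipse (r δ : ℝ) : Set (ℝ × ℝ) :=
  {p | p.1 ^ 2 + p.2 ^ 2 - 2 * p.1 * p.2 * cos δ ≤ r ^ 2 * sin δ ^ 2}

lemma measurableSet_chordEllipse (r δ : ℝ) : MeasurableSet (chordEllipse r δ) :=
  measurableSet_le (by fun_prop) (by fun_prop)

lemma volume_disc (r : ℝ) (hr : 0 ≤ r) :
    volume {p : ℝ × ℝ | p.1 ^ 2 + p.2 ^ 2 ≤ r ^ 2} = ENNReal.ofReal (π * r ^ 2) := by
  have hmeas : MeasurableSet {p : ℝ × ℝ | p.1 ^ 2 + p.2 ^ 2 ≤ r ^ 2} :=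
    measurableSet_le (by fun_prop) (by fun_prop)
  rw [← Complex.volume_preserving_equiv_real_prod.measure_preimage hmeas.nullMeasurableSet]
  have h : Complex.measurableEquivRealProd ⁻¹' {p : ℝ × ℝ | p.1 ^ 2 + p.2 ^ 2 ≤ r ^ 2}
      = Metric.closedBall 0 r := by
    ext z
    simp only [Set.mem_preimage, Complex.measurableEquivRealProd_apply, Set.mem_ofPred_eq,
      mem_closedBall_zero_iff]
    rw [← abs_of_nonneg hr, ← abs_norm, ← sq_le_sq, ← Complex.normSq_eq_norm_sq,
      Complex.normSq_apply, sq_abs, sq, sq z.im]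
  rw [h, Complex.volume_closedBall, mul_comm π, ENNReal.ofReal_mul (by positivity),
    ENNReal.ofReal_pow hr, ← NNReal.coe_real_pi, ENNReal.ofReal_coe_nnreal]

lemma volume_chordEllipse (r δ : ℝ) (hr : 0 ≤ r) (hs : sin δ ≠ 0) :
    volume (chordEllipse r δ) = ENNReal.ofReal (π * r ^ 2 * |sin δ|) := by
  let M : Matrix (Fin 2) (Fin 2) ℝ := !![1, 0; cos δ, sin δ]
  let L : ℝ × ℝ →ₗ[ℝ] ℝ × ℝ :=
    Matrix.toLin (Module.Basis.finTwoProd ℝ) (Module.Basis.finTwoProd ℝ) M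
  have hdet : LinearMap.det L = sin δ := by
    simp [L, M, LinearMap.det_toLin, Matrix.det_fin_two]
  have hL (p : ℝ × ℝ) : L p = (p.1, cos δ * p.1 + sin δ * p.2) := by
    simp [L, M, Matrix.toLin_finTwoProd_apply]
  have hpre : L ⁻¹' chordEllipse r δ = {p : ℝ × ℝ | p.1 ^ 2 + p.2 ^ 2 ≤ r ^ 2} := by
    ext p
    simp only [Set.mem_preimage, hL, chordEllipse, Set.mem_ofPred_eq]
    have e : p.1 ^ 2 + (cos δ * p.1 + sin δ * p.2) ^ 2
        - 2 * p.1 * (cos δ * p.1 + sin δ * p.2) * cos δ = (p.1 ^ 2 + p.2 ^ 2) * sin δ ^ 2 := by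
      linear_combination (p.1 ^ 2) * (- sin_sq_add_cos_sq δ)
    rw [e]
    exact mul_le_mul_iff_left₀ (by positivity)
  have h := Measure.addHaar_preimage_linearMap (volume : Measure (ℝ × ℝ)) (f := L)
    (by rwa [hdet]) (chordEllipse r δ)
  rw [hpre, volume_disc r hr, hdet, abs_inv] at h
  rw [mul_comm _ |sin δ|, ENNReal.ofReal_mul (abs_nonneg _), h, ← mul_assoc,
    ← ENNReal.ofReal_mul (abs_nonneg _), mul_inv_cancel₀ (abs_ne_zero.2 hs), ENNReal.ofReal_one,
    one_mul]

lemma volume_fst_eq_zero : volume {p : ℝ × ℝ | p.1 = 0} = 0 := by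
  have : {p : ℝ × ℝ | p.1 = 0} = {0} ×ˢ Set.univ := by ext; simp
  rw [this, Measure.volume_eq_prod, Measure.prod_prod]; simp

lemma volume_snd_eq_zero : volume {p : ℝ × ℝ | p.2 = 0} = 0 := by
  have : {p : ℝ × ℝ | p.2 = 0} = Set.univ ×ˢ {0} := by ext; simp
  rw [this, Measure.volume_eq_prod, Measure.prod_prod]; simp

/-- A measurable set symmetric about the origin is split into two pairs of congruent pieces by
the coordinate axes. -/
lemma volume_eq_two_mul_quadrants {E : Set (ℝ × ℝ)} (hE : MeasurableSet E)
    (hneg : ∀ p ∈ E, -p ∈ E) :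
    volume E = 2 * (volume (E ∩ {p | 0 ≤ p.1 ∧ 0 ≤ p.2})
      + volume (E ∩ {p | p.1 ≤ 0 ∧ 0 ≤ p.2})) := by
  have hU : MeasurableSet {p : ℝ × ℝ | 0 ≤ p.2} := measurableSet_le (by fun_prop) (by fun_prop)
  have hV : MeasurableSet {p : ℝ × ℝ | 0 ≤ p.1} := measurableSet_le (by fun_prop) (by fun_prop)
  have h1 := measure_inter_add_sdiff (μ := volume) E hU
  have h2 := measure_inter_add_sdiff (μ := volume) (E ∩ {p : ℝ × ℝ | 0 ≤ p.2}) hV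
  have h3 : volume (E \ {p : ℝ × ℝ | 0 ≤ p.2}) = volume (E ∩ {p : ℝ × ℝ | 0 ≤ p.2}) := by
    rw [← (Measure.measurePreserving_neg (volume : Measure (ℝ × ℝ))).measure_preimage
      (hE.diff hU).nullMeasurableSet]
    apply measure_congr
    have hz : ∀ᵐ p : ℝ × ℝ, p.2 ≠ 0 := by
      rw [ae_iff]; simpa using volume_snd_eq_zero
    filter_upwards [hz] with p hp
    apply propext
    change (-p ∈ E ∧ ¬ 0 ≤ (-p).2) ↔ (p ∈ E ∧ 0 ≤ p.2)
    have hEp : -p ∈ E ↔ p ∈ E := ⟨fun h => by simpa using hneg _ h, hneg p⟩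
    have hlt : ¬ 0 ≤ (-p).2 ↔ 0 ≤ p.2 := by
      rw [Prod.snd_neg, not_le, neg_lt_zero]
      exact ⟨le_of_lt, fun h => lt_of_le_of_ne h hp.symm⟩
    rw [hEp, hlt]
  have h4 : volume ((E ∩ {p : ℝ × ℝ | 0 ≤ p.2}) \ {p : ℝ × ℝ | 0 ≤ p.1})
      = volume (E ∩ {p | p.1 ≤ 0 ∧ 0 ≤ p.2}) := by
    apply measure_congr
    have hz : ∀ᵐ p : ℝ × ℝ, p.1 ≠ 0 := by
      rw [ae_iff]; simpa using volume_fst_eq_zero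
    filter_upwards [hz] with p hp
    apply propext
    change ((p ∈ E ∧ 0 ≤ p.2) ∧ ¬ 0 ≤ p.1) ↔ (p ∈ E ∧ p.1 ≤ 0 ∧ 0 ≤ p.2)
    have hlt : ¬ 0 ≤ p.1 ↔ p.1 ≤ 0 := by
      rw [not_le]
      exact ⟨le_of_lt, fun h => lt_of_le_of_ne h hp⟩
    rw [hlt]; tauto
  have h5 : (E ∩ {p : ℝ × ℝ | 0 ≤ p.2}) ∩ {p : ℝ × ℝ | 0 ≤ p.1}
      = E ∩ {p | 0 ≤ p.1 ∧ 0 ≤ p.2} := by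
    ext p; simp only [Set.mem_inter_iff, Set.mem_ofPred_eq]; tauto
  rw [h4, h5] at h2
  rw [← h1, h3, ← h2, two_mul]

/-- The probability, over the radii, that two chords at angle `δ` meet within distance `r` of the
centre. -/
noncomputable def radiusProb (r δ : ℝ) : ENNReal :=
  (unifRadius.prod unifRadius) {p : ℝ × ℝ | interDist p.1 p.2 0 δ ≤ r}

lemma radiusProb_eq_volume (r δ : ℝ) (hr0 : 0 ≤ r) (hr1 : r ≤ 1) (hs : sin δ ≠ 0) :
    radiusProb r δ = volume (chordEllipse r δ ∩ {p | 0 ≤ p.1 ∧ 0 ≤ p.2}) := by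
  rw [radiusProb, unifRadius, Measure.prod_restrict, ← Measure.volume_eq_prod]
  have hset : {p : ℝ × ℝ | interDist p.1 p.2 0 δ ≤ r} = chordEllipse r δ := by
    ext p
    simp only [Set.mem_ofPred_eq, interDist, chordEllipse, sub_zero]
    rw [div_le_iff₀ (abs_pos.2 hs), Real.sqrt_le_left (by positivity), mul_pow, sq_abs]
  rw [hset, Measure.restrict_apply (measurableSet_chordEllipse r δ)]
  congr 1
  ext p
  simp only [chordEllipse, Set.mem_inter_iff, Set.mem_ofPred_eq, Set.mem_prod, Set.mem_Icc]
  constructor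
  · rintro ⟨h, ⟨h1, -⟩, h2, -⟩
    exact ⟨h, h1, h2⟩
  · rintro ⟨h, h1, h2⟩
    have hs2 : 0 < sin δ ^ 2 := by positivity
    have hr2 : r ^ 2 ≤ 1 := pow_le_one₀ hr0 hr1
    have key (a b : ℝ) (hab : a ^ 2 + b ^ 2 - 2 * a * b * cos δ ≤ r ^ 2 * sin δ ^ 2) : a ≤ 1 := by
      have e : a ^ 2 * sin δ ^ 2 + (b - a * cos δ) ^ 2
          = a ^ 2 + b ^ 2 - 2 * a * b * cos δ := by
        linear_combination a ^ 2 * sin_sq_add_cos_sq δ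
      have : a ^ 2 * sin δ ^ 2 ≤ r ^ 2 * sin δ ^ 2 := by nlinarith [sq_nonneg (b - a * cos δ)]
      have := le_of_mul_le_mul_right this hs2
      nlinarith
    exact ⟨h, ⟨h1, key _ _ h⟩, h2, key _ p.1 (by linarith)⟩

lemma radiusProb_add_radiusProb_add_pi (r δ : ℝ) (hr0 : 0 ≤ r) (hr1 : r ≤ 1) (hs : sin δ ≠ 0) :
    2 * (radiusProb r δ + radiusProb r (δ + π)) = ENNReal.ofReal (π * r ^ 2 * |sin δ|) := by
  rw [← volume_chordEllipse r δ hr0 hs,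
    volume_eq_two_mul_quadrants (measurableSet_chordEllipse r δ),
    radiusProb_eq_volume r δ hr0 hr1 hs,
    radiusProb_eq_volume r (δ + π) hr0 hr1 (by rwa [sin_add_pi, neg_ne_zero])]
  · have hmp : MeasurePreserving (Prod.map Neg.neg id) (volume : Measure (ℝ × ℝ)) volume :=
      (Measure.measurePreserving_neg (volume : Measure ℝ)).prod (MeasurePreserving.id volume)
    have h1 : MeasurableSet {p : ℝ × ℝ | p.1 ≤ 0} := measurableSet_le (by fun_prop) (by fun_prop)
    have h2 : MeasurableSet {p : ℝ × ℝ | 0 ≤ p.2} := measurableSet_le (by fun_prop) (by fun_prop)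
    have hm : MeasurableSet (chordEllipse r δ ∩ {p | p.1 ≤ 0 ∧ 0 ≤ p.2}) :=
      (measurableSet_chordEllipse r δ).inter (h1.inter h2)
    rw [← hmp.measure_preimage hm.nullMeasurableSet]
    congr 3
    ext p
    simp [chordEllipse]
  · intro p hp
    simpa [chordEllipse] using hp

lemma measurableSet_interDist_le (r : ℝ) :
    MeasurableSet {q : (ℝ × ℝ) × ℝ × ℝ | interDist q.1.1 q.1.2 q.2.1 q.2.2 ≤ r} := by
  unfold interDist
  exact measurableSet_le (by fun_prop) (by fun_prop)

instance : IsFiniteMeasure unifRadius := by unfold unifRadius; infer_instance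

instance : SFinite unifCircle := by unfold unifCircle; infer_instance

lemma measurable_radiusProb (r : ℝ) : Measurable (radiusProb r) := by
  have h : Measurable fun δ : ℝ => (unifRadius.prod unifRadius)
      ((fun p : ℝ × ℝ => (p, ((0 : ℝ), δ))) ⁻¹'
        {q : (ℝ × ℝ) × ℝ × ℝ | interDist q.1.1 q.1.2 q.2.1 q.2.2 ≤ r}) :=
    (measurable_measure_prodMk_right (measurableSet_interDist_le r)).comp
      (measurable_const.prodMk measurable_id)
  exact h

lemma periodic_radiusProb (r : ℝ) : Function.Periodic (radiusProb r) (2 * π) := by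
  intro δ
  simp [radiusProb, interDist]

lemma setLIntegral_Ioc_eq_of_periodic {f : ℝ → ENNReal} {T : ℝ} (hf : Function.Periodic f T)
    (hT : 0 < T) (a b : ℝ) :
    ∫⁻ x in Set.Ioc a (a + T), f x = ∫⁻ x in Set.Ioc b (b + T), f x := by
  refine (isAddFundamentalDomain_Ioc hT a).setLIntegral_eq (isAddFundamentalDomain_Ioc hT b) f ?_
  rintro ⟨_, n, rfl⟩ x
  simpa [add_comm, AddSubmonoid.vadd_def, AddSubgroup.vadd_def] using hf.int_mul n x

lemma setLIntegral_Ioc_comp_add_right (f : ℝ → ENNReal) (a b c : ℝ) :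
    ∫⁻ x in Set.Ioc a b, f (x + c) = ∫⁻ x in Set.Ioc (a + c) (b + c), f x := by
  have h := (measurePreserving_add_right (volume : Measure ℝ) c).setLIntegral_comp_preimage_emb
    (measurableEmbedding_addRight c) f (Set.Ioc (a + c) (b + c))
  simpa using h

lemma setLIntegral_Ioc_comp_add_right_of_periodic {f : ℝ → ENNReal} {T : ℝ}
    (hf : Function.Periodic f T) (hT : 0 < T) (c : ℝ) :
    ∫⁻ x in Set.Ioc 0 T, f (x + c) = ∫⁻ x in Set.Ioc 0 T, f x := by
  rw [setLIntegral_Ioc_comp_add_right, zero_add, add_comm T c,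
    setLIntegral_Ioc_eq_of_periodic hf hT c 0, zero_add]

lemma integral_abs_sin_zero_two_pi : ∫ x in (0 : ℝ)..(2 * π), |sin x| = 4 := by
  have hi (a b : ℝ) : IntervalIntegrable (fun x => |sin x|) volume a b :=
    (continuous_sin.abs).intervalIntegrable a b
  have h0 : ∫ x in (0 : ℝ)..π, |sin x| = 2 := by
    rw [intervalIntegral.integral_congr (g := sin), integral_sin]
    · norm_num
    · intro x hx
      rw [Set.uIcc_of_le pi_pos.le] at hx
      exact abs_of_nonneg (sin_nonneg_of_mem_Icc hx)
  have h1 : ∫ x in π..(2 * π), |sin x| = 2 := by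
    have h := intervalIntegral.integral_comp_add_right (a := 0) (b := π) (fun x => |sin x|) π
    simp only [sin_add_pi, abs_neg, zero_add, ← two_mul] at h
    rw [← h, h0]
  rw [← intervalIntegral.integral_add_adjacent_intervals (hi 0 π) (hi π (2 * π)), h0, h1]
  norm_num

lemma lintegral_abs_sin (k : ℝ) (hk : 0 ≤ k) :
    ∫⁻ x in Set.Ioc 0 (2 * π), ENNReal.ofReal (k * |sin x|) = ENNReal.ofReal (4 * k) := by
  rw [← ofReal_integral_eq_lintegral_ofReal, ← intervalIntegral.integral_of_le two_pi_pos.le,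
    intervalIntegral.integral_const_mul, integral_abs_sin_zero_two_pi, mul_comm]
  · exact ((continuous_const.mul continuous_sin.abs).intervalIntegrable 0 (2 * π)).1
  · exact Filter.Eventually.of_forall fun x => by positivity

lemma ae_sin_ne_zero : ∀ᵐ x : ℝ, sin x ≠ 0 := by
  have h : {x : ℝ | sin x = 0} = Set.range fun n : ℤ => (n : ℝ) * π := by
    ext x; simp [sin_eq_zero_iff]
  rw [ae_iff]
  simp only [not_not, h]
  exact (Set.countable_range _).measure_zero _

lemma lintegral_radiusProb (r : ℝ) (hr0 : 0 ≤ r) (hr1 : r ≤ 1) :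
    ∫⁻ δ in Set.Ioc 0 (2 * π), radiusProb r δ = ENNReal.ofReal (π * r ^ 2) := by
  have h : ∫⁻ δ in Set.Ioc 0 (2 * π), 2 * (radiusProb r δ + radiusProb r (δ + π))
      = ENNReal.ofReal (4 * (π * r ^ 2)) := by
    rw [← lintegral_abs_sin _ (by positivity)]
    refine lintegral_congr_ae (ae_restrict_of_ae ?_)
    filter_upwards [ae_sin_ne_zero] with δ hδ
    exact radiusProb_add_radiusProb_add_pi r δ hr0 hr1 hδ
  have hm := measurable_radiusProb r
  rw [lintegral_const_mul _ (by fun_prop), lintegral_add_left hm,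
    setLIntegral_Ioc_comp_add_right_of_periodic (periodic_radiusProb r) two_pi_pos, ← two_mul,
    ← mul_assoc, ENNReal.ofReal_mul (by norm_num)] at h
  have h4 : ENNReal.ofReal 4 = 2 * 2 := by norm_num
  rw [h4] at h
  exact (ENNReal.mul_right_inj (by norm_num) (by finiteness)).1 h

lemma lintegral_unifCircle (f : ℝ → ENNReal) :
    ∫⁻ x, f x ∂unifCircle = (ENNReal.ofReal (2 * π))⁻¹ * ∫⁻ x in Set.Ioc 0 (2 * π), f x := by
  rw [unifCircle, lintegral_smul_measure, restrict_Ico_eq_restrict_Ioc, smul_eq_mul]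

theorem bertrand_uniform_radius_small (r : ℝ) (hr0 : 0 ≤ r) (hr1 : r ≤ 1) :
    (unifRadius.prod (unifRadius.prod (unifCircle.prod unifCircle)))
      {q : ℝ × ℝ × ℝ × ℝ | interDist q.1 q.2.1 q.2.2.1 q.2.2.2 ≤ r} =
    ENNReal.ofReal (r ^ 2 / 2) := by
  have hinner (θ₁ : ℝ) : ∫⁻ θ₂, radiusProb r (θ₂ - θ₁) ∂unifCircle
      = ENNReal.ofReal (r ^ 2 / 2) := by
    simp only [sub_eq_add_neg]
    rw [lintegral_unifCircle, setLIntegral_Ioc_comp_add_right_of_periodic (periodic_radiusProb r)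
      two_pi_pos, lintegral_radiusProb r hr0 hr1, ← ENNReal.ofReal_inv_of_pos two_pi_pos,
      ← ENNReal.ofReal_mul (by positivity)]
    congr 1
    field_simp
  rw [← (measurePreserving_prodAssoc unifRadius unifRadius
    (unifCircle.prod unifCircle)).measure_preimage_equiv]
  have hS := measurableSet_interDist_le r
  change ((unifRadius.prod unifRadius).prod (unifCircle.prod unifCircle))
    {q : (ℝ × ℝ) × ℝ × ℝ | interDist q.1.1 q.1.2 q.2.1 q.2.2 ≤ r} = _
  rw [Measure.prod_apply_symm hS]
  have hsec (θ : ℝ × ℝ) : (unifRadius.prod unifRadius) ((fun p : ℝ × ℝ => (p, θ)) ⁻¹'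
      {q : (ℝ × ℝ) × ℝ × ℝ | interDist q.1.1 q.1.2 q.2.1 q.2.2 ≤ r})
      = radiusProb r (θ.2 - θ.1) := by
    simp [radiusProb, interDist]
  have hm := measurable_radiusProb r
  simp only [hsec]
  rw [lintegral_prod _ (by fun_prop)]
  simp only [hinner]
  rw [lintegral_unifCircle, setLIntegral_const, Real.volume_Ioc, sub_zero, mul_left_comm,
    ENNReal.inv_mul_cancel (by simpa using pi_pos) (by finiteness), mul_one]
end

section
/- Let μ_II be the probability measure on [0,1] with cumulative distribution function F(x) = x² (i.e. density 2x on [0,1]) and let ν be the uniform probability measure on [0,2π). Then for every r ≥ 1, the measure of the set {(t₁,t₂,θ₁,θ₂) : D(t₁,t₂,θ₁,θ₂) ≤ r} with respect to μ_II ⊗ μ_II ⊗ ν ⊗ ν equals (2/π)·arccos(1/r) + (3r⁴/(4π))·arcsin(1/r) − ((3r² + 2)/(4π))·sqrt(r² − 1). -/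
open MeasureTheory Real

/-- The probability measure on `[0, 1]` with density `2t` (Bertrand's "uniform
midpoint" chord: the distance to the origin of a chord whose midpoint is uniform
in the unit disk). -/
noncomputable def unifMidpoint : Measure ℝ :=
  (volume.restrict (Set.Icc 0 1)).withDensity fun t => ENNReal.ofReal (2 * t)

instance : SFinite unifMidpoint := by unfold unifMidpoint; infer_instance

lemma ae_unifMidpoint_mem_Icc : ∀ᵐ t ∂unifMidpoint, t ∈ Set.Icc (0 : ℝ) 1 :=
  (withDensity_absolutelyContinuous _ _).ae_le (ae_restrict_mem measurableSet_Icc)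

lemma lintegral_unifMidpoint {f : ℝ → ℝ} (hf : Continuous f)
    (hf0 : ∀ t ∈ Set.Icc (0 : ℝ) 1, 0 ≤ f t) :
    ∫⁻ t, ENNReal.ofReal (f t) ∂unifMidpoint =
      ENNReal.ofReal (∫ t in (0 : ℝ)..1, 2 * t * f t) := by
  have hcont : Continuous fun t : ℝ => 2 * t * f t := by fun_prop
  rw [unifMidpoint, lintegral_withDensity_eq_lintegral_mul _ (by fun_prop) (by fun_prop),
    intervalIntegral.integral_of_le zero_le_one, ← integral_Icc_eq_integral_Ioc,
    ofReal_integral_eq_lintegral_ofReal (hcont.integrableOn_Icc)]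
  · refine setLIntegral_congr_fun measurableSet_Icc fun t ht => ?_
    simp only [Pi.mul_apply]
    exact (ENNReal.ofReal_mul (by linarith [ht.1])).symm
  · filter_upwards [ae_restrict_mem measurableSet_Icc] with t ht
    exact mul_nonneg (by linarith [ht.1]) (hf0 t ht)

lemma interDist_cos_le_iff {r α β ψ : ℝ} (hr : 0 < r) (hα : α ∈ Set.Icc 0 (π / 2))
    (hβ : β ∈ Set.Icc 0 (π / 2)) (hψ : ψ ∈ Set.Ioo 0 π) :
    interDist (r * cos α) (r * cos β) 0 ψ ≤ r ↔ ψ ∈ Set.Icc |α - β| (α + β) := by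
  have hsin : 0 < sin ψ := sin_pos_of_mem_Ioo hψ
  have hab : 0 ≤ sin α * sin β :=
    mul_nonneg (sin_nonneg_of_nonneg_of_le_pi hα.1 (by linarith [hα.2, pi_pos]))
      (sin_nonneg_of_nonneg_of_le_pi hβ.1 (by linarith [hβ.2, pi_pos]))
  have hlow : |α - β| ≤ ψ ↔ cos ψ ≤ cos (α - β) := by
    rw [← cos_abs (α - β)]
    refine (strictAntiOn_cos.le_iff_ge ⟨hψ.1.le, hψ.2.le⟩ ⟨abs_nonneg _, ?_⟩).symm
    rw [abs_le]
    constructor <;> linarith [hα.1, hα.2, hβ.1, hβ.2, pi_pos]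
  have hupp : ψ ≤ α + β ↔ cos (α + β) ≤ cos ψ :=
    (strictAntiOn_cos.le_iff_ge ⟨by linarith [hα.1, hβ.1], by linarith [hα.2, hβ.2]⟩
      ⟨hψ.1.le, hψ.2.le⟩).symm
  rw [Set.mem_Icc, hlow, hupp, cos_sub, cos_add, interDist, sub_zero, abs_of_pos hsin,
    div_le_iff₀ hsin, sqrt_le_left (by positivity)]
  have hsq : (cos ψ - cos α * cos β) ^ 2 ≤ (sin α * sin β) ^ 2 ↔
      (r * cos α) ^ 2 + (r * cos β) ^ 2 - 2 * (r * cos α) * (r * cos β) * cos ψ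
        ≤ (r * sin ψ) ^ 2 := by
    have key : (r * sin ψ) ^ 2 - ((r * cos α) ^ 2 + (r * cos β) ^ 2
        - 2 * (r * cos α) * (r * cos β) * cos ψ) =
        r ^ 2 * ((sin α * sin β) ^ 2 - (cos ψ - cos α * cos β) ^ 2) := by
      simp only [mul_pow, sin_sq]; ring
    rw [← sub_nonneg (b := (cos ψ - cos α * cos β) ^ 2), ← sub_nonneg (a := (r * sin ψ) ^ 2), key]
    exact (mul_nonneg_iff_of_pos_left (by positivity)).symm
  rw [← hsq, sq_le_sq, abs_of_nonneg hab, abs_le]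
  constructor <;> rintro ⟨h1, h2⟩ <;> constructor <;> linarith

lemma interDist_eq_zero_left (s t θ₁ θ₂ : ℝ) :
    interDist s t θ₁ θ₂ = interDist s t 0 (θ₂ - θ₁) := by
  simp [interDist]

lemma volume_Ioc_inter_interDist_le {r s t : ℝ} (hr : 1 ≤ r) (hs : s ∈ Set.Icc (0 : ℝ) 1)
    (ht : t ∈ Set.Icc (0 : ℝ) 1) :
    volume ({ψ | interDist s t 0 ψ ≤ r} ∩ Set.Ioc (-π) (-π + 2 * π)) =
      ENNReal.ofReal (4 * arccos (max s t / r)) := by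
  have hr0 : 0 < r := by linarith
  have aux : ∀ x ∈ Set.Icc (0 : ℝ) 1,
      arccos (x / r) ∈ Set.Icc 0 (π / 2) ∧ r * cos (arccos (x / r)) = x := by
    intro x hx
    have h0 : 0 ≤ x / r := div_nonneg hx.1 hr0.le
    refine ⟨⟨arccos_nonneg _, arccos_le_pi_div_two.2 h0⟩, ?_⟩
    rw [cos_arccos (by linarith) ((div_le_one hr0).2 (hx.2.trans hr))]
    field_simp
  obtain ⟨hα, hsα⟩ := aux s hs
  obtain ⟨hβ, htβ⟩ := aux t ht
  have hmin : arccos (max s t / r) = min (arccos (s / r)) (arccos (t / r)) := by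
    rw [← max_div_div_right hr0.le]
    exact antitone_arccos.map_max
  have hiff := fun ψ (hψ : ψ ∈ Set.Ioo 0 π) => interDist_cos_le_iff hr0 hα hβ hψ
  rw [hsα, htβ] at hiff
  rw [hmin]
  set α := arccos (s / r)
  set β := arccos (t / r)
  have hneg : ∀ ψ, interDist s t 0 (-ψ) = interDist s t 0 ψ := fun ψ => by simp [interDist]
  have hle : |α - β| ≤ α + β := by
    rw [abs_le]; constructor <;> linarith [hα.1, hβ.1]
  have hae : ({ψ | interDist s t 0 ψ ≤ r} ∩ Set.Ioc (-π) (-π + 2 * π) : Set ℝ) =ᵐ[volume]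
      (Set.Ioo (-(α + β)) (-|α - β|) ∪ Set.Ioo |α - β| (α + β) : Set ℝ) := by
    have hfin : ({0, π, |α - β|, α + β, -|α - β|, -(α + β)} : Set ℝ).Finite := by simp
    filter_upwards [hfin.measure_zero volume |> compl_mem_ae_iff.2] with ψ hψ
    simp only [Set.mem_compl_iff, Set.mem_insert_iff, Set.mem_singleton_iff, not_or] at hψ
    obtain ⟨h0, hpi, h1, h2, h3, h4⟩ := hψ
    apply propext
    change (interDist s t 0 ψ ≤ r ∧ -π < ψ ∧ ψ ≤ -π + 2 * π) ↔
      (-(α + β) < ψ ∧ ψ < -|α - β|) ∨ (|α - β| < ψ ∧ ψ < α + β)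
    have habs := abs_nonneg (α - β)
    have hsum : α + β ≤ π := by linarith [hα.2, hβ.2]
    constructor
    · rintro ⟨h, hl, hu⟩
      have hu' : ψ < π := lt_of_le_of_ne (by linarith) hpi
      rcases lt_or_gt_of_ne h0 with hψ | hψ
      · left
        rw [← hneg, hiff _ ⟨by linarith, by linarith⟩] at h
        exact ⟨lt_of_le_of_ne (by linarith [h.2]) (Ne.symm h4),
          lt_of_le_of_ne (by linarith [h.1]) h3⟩
      · right
        rw [hiff _ ⟨by linarith, by linarith⟩] at h
        exact ⟨lt_of_le_of_ne h.1 (Ne.symm h1), lt_of_le_of_ne h.2 h2⟩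
    · rintro (⟨hl, hu⟩ | ⟨hl, hu⟩)
      · refine ⟨?_, by linarith, by linarith⟩
        rw [← hneg, hiff _ ⟨by linarith, by linarith⟩]
        exact ⟨by linarith, by linarith⟩
      · refine ⟨?_, by linarith, by linarith⟩
        rw [hiff _ ⟨by linarith, by linarith⟩]
        exact ⟨hl.le, hu.le⟩
  rw [measure_congr hae, measure_union _ measurableSet_Ioo, volume_Ioo, volume_Ioo,
    ← ENNReal.ofReal_add (by linarith) (by linarith)]
  · congr 1
    rcases le_total α β with h | h
    · rw [min_eq_left h, abs_of_nonpos (by linarith)]; ring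
    · rw [min_eq_right h, abs_of_nonneg (by linarith)]; ring
  · rw [Set.disjoint_left]
    rintro x ⟨_, hx⟩ ⟨hx', _⟩
    linarith [abs_nonneg (α - β)]

lemma measurable_interDist :
    Measurable fun q : ℝ × ℝ × ℝ × ℝ => interDist q.1 q.2.1 q.2.2.1 q.2.2.2 := by
  unfold interDist
  fun_prop

lemma unifCircle_interDist_le {r s t : ℝ} (hr : 1 ≤ r) (hs : s ∈ Set.Icc (0 : ℝ) 1)
    (ht : t ∈ Set.Icc (0 : ℝ) 1) (θ : ℝ) :
    unifCircle {θ₂ | interDist s t θ θ₂ ≤ r} =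
      ENNReal.ofReal (2 / π * arccos (max s t / r)) := by
  have hmeas : Measurable fun ψ => interDist s t 0 ψ := by unfold interDist; fun_prop
  set A : Set ℝ := {ψ | interDist s t 0 ψ ≤ r}
  have hA : MeasurableSet A := measurableSet_le hmeas measurable_const
  have hpre : {θ₂ | interDist s t θ θ₂ ≤ r} = (fun x => x - θ) ⁻¹' A := by
    ext x
    simp only [Set.mem_ofPred_eq, Set.mem_preimage, A, interDist_eq_zero_left s t θ x]
  have hshift : volume ((fun x => x - θ) ⁻¹' A ∩ Set.Ioc 0 (0 + 2 * π)) =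
      volume (A ∩ Set.Ioc (-θ) (-θ + 2 * π)) := by
    rw [← (measurePreserving_sub_right volume θ).measure_preimage
      (hA.inter measurableSet_Ioc).nullMeasurableSet, Set.preimage_inter]
    congr 2
    ext x
    simp only [Set.mem_Ioc, Set.mem_preimage]
    constructor <;> rintro ⟨h1, h2⟩ <;> constructor <;> linarith
  have hper : ∀ ψ, interDist s t 0 (ψ + 2 * π) = interDist s t 0 ψ := fun ψ => by
    simp [interDist]
  have hdom : volume (A ∩ Set.Ioc (-θ) (-θ + 2 * π)) =
      volume (A ∩ Set.Ioc (-π) (-π + 2 * π)) := by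
    refine (isAddFundamentalDomain_Ioc two_pi_pos (-θ)).measure_set_eq
      (isAddFundamentalDomain_Ioc two_pi_pos (-π)) hA ?_
    rintro ⟨_, n, rfl⟩
    ext x
    have := (show Function.Periodic (interDist s t 0) (2 * π) from hper).zsmul n x
    change interDist s t 0 (n • (2 * π) + x) ≤ r ↔ interDist s t 0 x ≤ r
    rw [add_comm, this]
  rw [unifCircle, Measure.smul_apply, hpre, restrict_Ico_eq_restrict_Ioc,
    Measure.restrict_apply ((measurable_sub_const θ) hA), ← zero_add (2 * π), hshift, hdom,
    volume_Ioc_inter_interDist_le hr hs ht, smul_eq_mul, zero_add,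
    ← ENNReal.ofReal_inv_of_pos two_pi_pos, ← ENNReal.ofReal_mul (by positivity)]
  congr 1
  field_simp
  ring

lemma unifCircle_univ : unifCircle Set.univ = 1 := by
  rw [unifCircle, Measure.smul_apply, Measure.restrict_apply_univ, volume_Ico, sub_zero,
    smul_eq_mul]
  exact ENNReal.inv_mul_cancel (by simp [pi_pos]) ENNReal.ofReal_ne_top

/-- If `h` is continuous, the maximum of two independent variables with density `2t` on `[0, 1]`
has density `4t³`. -/
lemma lintegral_lintegral_unifMidpoint_max {h : ℝ → ℝ} (hc : Continuous h) (h0 : ∀ x, 0 ≤ h x) :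
    ∫⁻ s, ∫⁻ t, ENNReal.ofReal (h (max s t)) ∂unifMidpoint ∂unifMidpoint =
      ENNReal.ofReal (∫ t in (0 : ℝ)..1, 4 * t ^ 3 * h t) := by
  have hg : Continuous fun t : ℝ => 2 * t * h t := by fun_prop
  set K : ℝ → ℝ := fun x => ∫ t in x..1, 2 * t * h t
  have hK : ∀ x, HasDerivAt K (-(2 * x * h x)) x := fun x =>
    intervalIntegral.integral_hasDerivAt_left (hg.intervalIntegrable _ _)
      (hg.stronglyMeasurableAtFilter _ _) hg.continuousAt
  have hKc : Continuous K := continuous_iff_continuousAt.2 fun x => (hK x).continuousAt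
  have inner : ∀ s ∈ Set.Icc (0 : ℝ) 1,
      ∫⁻ t, ENNReal.ofReal (h (max s t)) ∂unifMidpoint =
        ENNReal.ofReal (s ^ 2 * h s + K s) := by
    intro s hs
    have hm : Continuous fun t : ℝ => 2 * t * h (max s t) := by fun_prop
    rw [lintegral_unifMidpoint (by fun_prop) fun _ _ => h0 _,
      ← intervalIntegral.integral_add_adjacent_intervals (hm.intervalIntegrable 0 s)
        (hm.intervalIntegrable s 1)]
    congr 2
    · have : ∫ t in (0 : ℝ)..s, 2 * t * h (max s t) = ∫ t in (0 : ℝ)..s, t * (2 * h s) := by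
        refine intervalIntegral.integral_congr fun t ht => ?_
        rw [Set.uIcc_of_le hs.1] at ht
        simp only [max_eq_left ht.2]; ring
      rw [this, intervalIntegral.integral_mul_const, integral_id]; ring
    · refine intervalIntegral.integral_congr fun t ht => ?_
      rw [Set.uIcc_of_le hs.2] at ht
      simp only [max_eq_right ht.1]
  have hK0 : ∀ s ∈ Set.Icc (0 : ℝ) 1, 0 ≤ K s := fun s hs =>
    intervalIntegral.integral_nonneg hs.2 fun t ht =>
      mul_nonneg (by linarith [hs.1, ht.1]) (h0 t)
  rw [lintegral_congr_ae (ae_unifMidpoint_mem_Icc.mono inner),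
    lintegral_unifMidpoint (by fun_prop) fun s hs =>
      add_nonneg (mul_nonneg (sq_nonneg s) (h0 s)) (hK0 s hs)]
  congr 1
  have hd : ∀ x ∈ Set.uIcc (0 : ℝ) 1, HasDerivAt (fun x => x ^ 2 * K x)
      (2 * x * (x ^ 2 * h x + K x) - 4 * x ^ 3 * h x) x := fun x _ => by
    refine ((hasDerivAt_pow 2 x).mul (hK x)).congr_deriv ?_
    push_cast; ring
  have hFTC := intervalIntegral.integral_eq_sub_of_hasDerivAt hd
    (Continuous.intervalIntegrable (by fun_prop) _ _)
  rw [intervalIntegral.integral_sub (Continuous.intervalIntegrable (by fun_prop) _ _)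
    (Continuous.intervalIntegrable (by fun_prop) _ _)] at hFTC
  have hK1 : K 1 = 0 := intervalIntegral.integral_same
  rw [hK1] at hFTC
  linarith

lemma integral_pow_three_mul_arccos_div {r : ℝ} (hr : 1 ≤ r) :
    ∫ t in (0 : ℝ)..1, 4 * t ^ 3 * arccos (t / r) =
      arccos (1 / r) + 3 * r ^ 4 / 8 * arcsin (1 / r)
        - (3 * r ^ 2 + 2) / 8 * √(r ^ 2 - 1) := by
  have hr0 : 0 < r := by linarith
  have hd : ∀ x ∈ Set.Ioo (0 : ℝ) 1, HasDerivAt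
      (fun x => x ^ 4 * arccos (x / r) + 3 * r ^ 4 / 8 * arcsin (x / r)
        - (3 * r ^ 2 * x + 2 * x ^ 3) / 8 * √(r ^ 2 - x ^ 2))
      (4 * x ^ 3 * arccos (x / r)) x := by
    intro x hx
    have hpos : 0 < r ^ 2 - x ^ 2 := by nlinarith [hx.1, hx.2]
    have hlt : x / r < 1 := (div_lt_one hr0).2 (by linarith [hx.2])
    have hgt : 0 < x / r := div_pos hx.1 hr0
    have hs : √(1 - (x / r) ^ 2) = √(r ^ 2 - x ^ 2) / r := by
      rw [← sqrt_sq hr0.le, ← sqrt_div' _ (by positivity), sqrt_sq hr0.le]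
      congr 1; field_simp
    have hq : HasDerivAt (fun x : ℝ => x / r) (1 / r) x := (hasDerivAt_id x).div_const r
    have hac := (hasDerivAt_arccos (x := x / r) (by linarith) (by linarith)).comp x hq
    have has := (hasDerivAt_arcsin (x := x / r) (by linarith) (by linarith)).comp x hq
    have hsqrt := ((hasDerivAt_pow 2 x).const_sub (r ^ 2)).sqrt hpos.ne'
    have hpoly := (((hasDerivAt_id x).const_mul (3 * r ^ 2)).add
      ((hasDerivAt_pow 3 x).const_mul 2)).div_const 8
    refine ((((hasDerivAt_pow 4 x).mul hac).add (has.const_mul (3 * r ^ 4 / 8))).sub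
      (hpoly.mul hsqrt)).congr_deriv ?_
    rw [hs]
    have hS : 0 < √(r ^ 2 - x ^ 2) := sqrt_pos.2 hpos
    have hSS : √(r ^ 2 - x ^ 2) ^ 2 = r ^ 2 - x ^ 2 := sq_sqrt hpos.le
    simp only [Function.comp, Pi.add_apply, id]
    set S := √(r ^ 2 - x ^ 2)
    push_cast
    field_simp
    ring_nf
    rw [hSS]
    ring
  have hcont : Continuous (fun x => x ^ 4 * arccos (x / r) + 3 * r ^ 4 / 8 * arcsin (x / r)
        - (3 * r ^ 2 * x + 2 * x ^ 3) / 8 * √(r ^ 2 - x ^ 2)) := by fun_prop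
  rw [intervalIntegral.integral_eq_sub_of_hasDerivAt_of_le zero_le_one hcont.continuousOn hd
    (Continuous.intervalIntegrable (by fun_prop) _ _)]
  simp

theorem bertrand_uniform_midpoint_large (r : ℝ) (hr : 1 ≤ r) :
    (unifMidpoint.prod (unifMidpoint.prod (unifCircle.prod unifCircle)))
      {q : ℝ × ℝ × ℝ × ℝ | interDist q.1 q.2.1 q.2.2.1 q.2.2.2 ≤ r} =
    ENNReal.ofReal (2 / π * Real.arccos (1 / r) + 3 * r ^ 4 / (4 * π) * Real.arcsin (1 / r)
      - (3 * r ^ 2 + 2) / (4 * π) * Real.sqrt (r ^ 2 - 1)) := by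
  have hS : MeasurableSet {q : ℝ × ℝ × ℝ × ℝ | interDist q.1 q.2.1 q.2.2.1 q.2.2.2 ≤ r} :=
    measurableSet_le measurable_interDist measurable_const
  have hslice : ∀ s ∈ Set.Icc (0 : ℝ) 1,
      (unifMidpoint.prod (unifCircle.prod unifCircle))
        (Prod.mk s ⁻¹' {q : ℝ × ℝ × ℝ × ℝ | interDist q.1 q.2.1 q.2.2.1 q.2.2.2 ≤ r}) =
      ∫⁻ t, ENNReal.ofReal (2 / π * arccos (max s t / r)) ∂unifMidpoint := by
    intro s hs
    have hS' := measurable_prodMk_left (x := s) hS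
    rw [Measure.prod_apply hS']
    refine lintegral_congr_ae (ae_unifMidpoint_mem_Icc.mono fun t ht => ?_)
    simp only
    rw [Measure.prod_apply (measurable_prodMk_left hS')]
    refine (lintegral_congr fun θ => unifCircle_interDist_le hr hs ht θ).trans ?_
    rw [lintegral_const, unifCircle_univ, mul_one]
  rw [Measure.prod_apply hS, lintegral_congr_ae (ae_unifMidpoint_mem_Icc.mono hslice),
    lintegral_lintegral_unifMidpoint_max (h := fun x => 2 / π * arccos (x / r)) (by fun_prop)
      fun x => mul_nonneg (by positivity) (arccos_nonneg _)]
  congr 1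
  have : ∀ t : ℝ, 4 * t ^ 3 * (2 / π * arccos (t / r)) =
      2 / π * (4 * t ^ 3 * arccos (t / r)) := fun t => by ring
  simp only [this]
  rw [intervalIntegral.integral_const_mul, integral_pow_three_mul_arccos_div hr]
  field_simp
  ring
end

section
/- (16/π³)·∫₀^{1/√2} arccos(t·√2)·arcsin(t)/√(1−t²) dt = 1/6 − (log 2 / π)². (This is the probability that the intersection point of two random chords of the unit circle with independent uniform endpoints lies within distance 1/√2 of the origin.) -/
open Real intervalIntegral

lemma abs_mul_sin_lt_one {r : ℝ} (hr : |r| < 1) (φ : ℝ) : |r * sin φ| < 1 := by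
  rw [abs_mul]
  nlinarith [abs_sin_le_one φ, abs_nonneg r, abs_nonneg (sin φ)]

lemma one_sub_sq_pos_of_abs_lt_one {x : ℝ} (hx : |x| < 1) : 0 < 1 - x ^ 2 := by
  have := (sq_lt_one_iff_abs_lt_one x).2 hx
  linarith

lemma continuous_comp_mul_sin {f : ℝ → ℝ} (hf : ContinuousOn f {x | |x| < 1}) {r : ℝ}
    (hr : |r| < 1) : Continuous fun φ => f (r * sin φ) :=
  hf.comp_continuous (by fun_prop) fun φ => abs_mul_sin_lt_one hr φ

/-- Differentiation under the integral sign along the family `f (r * sin φ)`. -/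
lemma hasDerivAt_integral_comp_mul_sin {f f' : ℝ → ℝ}
    (hf : ∀ x, |x| < 1 → HasDerivAt f (f' x) x) (hf' : ContinuousOn f' {x | |x| < 1})
    (a b : ℝ) {r : ℝ} (hr : |r| < 1) :
    HasDerivAt (fun r => ∫ φ in a..b, f (r * sin φ))
      (∫ φ in a..b, f' (r * sin φ) * sin φ) r := by
  obtain ⟨ρ, hrρ, hρ⟩ := exists_between hr
  have hfc : ContinuousOn f {x | |x| < 1} := fun x hx => (hf x hx).continuousAt.continuousWithinAt
  obtain ⟨C, hC⟩ := (isCompact_Icc (a := -ρ) (b := ρ)).exists_bound_of_continuousOn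
    (hf'.mono fun x hx => (abs_le.2 hx).trans_lt hρ)
  have hs : {x : ℝ | |x| < ρ} ∈ nhds r := (isOpen_lt continuous_abs continuous_const).mem_nhds hrρ
  refine (intervalIntegral.hasDerivAt_integral_of_dominated_loc_of_deriv_le
    (F := fun r φ => f (r * sin φ)) (F' := fun r φ => f' (r * sin φ) * sin φ)
    (bound := fun _ => C) hs ?_ ?_ ?_ ?_ ?_ ?_).2
  · filter_upwards [hs] with x hx
    exact (continuous_comp_mul_sin hfc (lt_trans hx hρ)).aestronglyMeasurable
  · exact (continuous_comp_mul_sin hfc hr).intervalIntegrable _ _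
  · exact ((continuous_comp_mul_sin hf' hr).mul continuous_sin).aestronglyMeasurable
  · refine .of_forall fun φ _ x hx => ?_
    have h1 : |x * sin φ| ≤ ρ := by
      rw [abs_mul]
      have hx' : |x| < ρ := hx
      nlinarith [abs_sin_le_one φ, abs_nonneg x, abs_nonneg (sin φ)]
    have h2 := hC _ (abs_le.1 h1)
    rw [norm_mul]
    have h3 : ‖sin φ‖ ≤ 1 := abs_sin_le_one φ
    nlinarith [norm_nonneg (f' (x * sin φ)), norm_nonneg (sin φ)]
  · exact intervalIntegrable_const
  · refine .of_forall fun φ _ x hx => ?_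
    have := (hf _ (abs_mul_sin_lt_one (lt_trans hx hρ) φ)).comp x
      ((hasDerivAt_id x).mul_const (sin φ))
    simpa [Function.comp_def] using this

lemma hasDerivAt_arcsin_of_abs_lt_one {x : ℝ} (hx : |x| < 1) :
    HasDerivAt arcsin (1 / √(1 - x ^ 2)) x :=
  hasDerivAt_arcsin (abs_lt.1 hx).1.ne' (abs_lt.1 hx).2.ne

lemma hasDerivAt_sqrt_one_sub_sq {x : ℝ} (hx : |x| < 1) :
    HasDerivAt (fun x => √(1 - x ^ 2)) (-x / √(1 - x ^ 2)) x := by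
  have h := one_sub_sq_pos_of_abs_lt_one hx
  refine (((hasDerivAt_pow 2 x).const_sub 1).sqrt h.ne').congr_deriv ?_
  have := (sqrt_pos.2 h).ne'
  field_simp
  norm_num

lemma hasDerivAt_arcsin_sq_half {x : ℝ} (hx : |x| < 1) :
    HasDerivAt (fun x => arcsin x ^ 2 / 2) (arcsin x / √(1 - x ^ 2)) x := by
  refine (((hasDerivAt_arcsin_of_abs_lt_one hx).pow 2).div_const 2).congr_deriv ?_
  simp
  ring_nf

lemma hasDerivAt_arcsin_div_sqrt {x : ℝ} (hx : |x| < 1) :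
    HasDerivAt (fun x => arcsin x / √(1 - x ^ 2))
      (1 / (1 - x ^ 2) + x * arcsin x / √(1 - x ^ 2) ^ 3) x := by
  have h := one_sub_sq_pos_of_abs_lt_one hx
  have hs := (sqrt_pos.2 h).ne'
  refine ((hasDerivAt_arcsin_of_abs_lt_one hx).div (hasDerivAt_sqrt_one_sub_sq hx) hs).congr_deriv ?_
  have hsq : √(1 - x ^ 2) ^ 2 = 1 - x ^ 2 := sq_sqrt h.le
  generalize √(1 - x ^ 2) = s at *
  rw [← hsq]
  field_simp
  ring

lemma hasDerivAt_mul_arcsin_div_sqrt {x : ℝ} (hx : |x| < 1) :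
    HasDerivAt (fun x => x * (arcsin x / √(1 - x ^ 2)))
      (x / (1 - x ^ 2) + arcsin x / √(1 - x ^ 2) ^ 3) x := by
  have h := one_sub_sq_pos_of_abs_lt_one hx
  have hs := (sqrt_pos.2 h).ne'
  refine ((hasDerivAt_id x).mul (hasDerivAt_arcsin_div_sqrt hx)).congr_deriv ?_
  have hsq : √(1 - x ^ 2) ^ 2 = 1 - x ^ 2 := sq_sqrt h.le
  have hx2 : x ^ 2 = 1 - √(1 - x ^ 2) ^ 2 := by linarith
  simp only [id]
  generalize √(1 - x ^ 2) = s at *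
  rw [← hsq]
  field_simp
  linear_combination arcsin x * hx2

lemma continuousOn_arcsin_div_sqrt :
    ContinuousOn (fun x => arcsin x / √(1 - x ^ 2)) {x | |x| < 1} :=
  fun _ hx => (hasDerivAt_arcsin_div_sqrt hx).continuousAt.continuousWithinAt

lemma continuousOn_deriv_mul_arcsin_div_sqrt :
    ContinuousOn (fun x => x / (1 - x ^ 2) + arcsin x / √(1 - x ^ 2) ^ 3) {x | |x| < 1} := by
  have h : ∀ x ∈ {x : ℝ | |x| < 1}, 1 - x ^ 2 ≠ 0 := fun x hx =>
    (one_sub_sq_pos_of_abs_lt_one hx).ne'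
  have h' : ∀ x ∈ {x : ℝ | |x| < 1}, √(1 - x ^ 2) ^ 3 ≠ 0 := fun x hx =>
    pow_ne_zero _ (sqrt_pos.2 (one_sub_sq_pos_of_abs_lt_one hx)).ne'
  exact (ContinuousOn.div (by fun_prop) (by fun_prop) h).add
    (ContinuousOn.div continuous_arcsin.continuousOn (by fun_prop) h')

lemma integral_deriv_mul_arcsin_div_sqrt_comp_mul_sin {r : ℝ} (hr : |r| < 1) :
    ∫ φ in (0 : ℝ)..(π / 2), (r * sin φ / (1 - (r * sin φ) ^ 2) +
      arcsin (r * sin φ) / √(1 - (r * sin φ) ^ 2) ^ 3) * sin φ = π / 2 * (r / (1 - r ^ 2)) := by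
  have hr' := one_sub_sq_pos_of_abs_lt_one hr
  rw [integral_eq_sub_of_hasDerivAt (f := fun φ => φ * (r / (1 - r ^ 2)) -
    cos φ * (arcsin (r * sin φ) / √(1 - (r * sin φ) ^ 2)) / (1 - r ^ 2))]
  · simp
  · intro φ _
    have hx := abs_mul_sin_lt_one hr φ
    have h := one_sub_sq_pos_of_abs_lt_one hx
    have hs := (sqrt_pos.2 h).ne'
    have hsq : √(1 - (r * sin φ) ^ 2) ^ 2 = 1 - (r * sin φ) ^ 2 := sq_sqrt h.le
    have hq := (hasDerivAt_arcsin_div_sqrt hx).comp φ ((hasDerivAt_sin φ).const_mul r)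
    refine (((hasDerivAt_id φ).mul_const (r / (1 - r ^ 2))).sub
      (((hasDerivAt_cos φ).mul hq).div_const (1 - r ^ 2))).congr_deriv ?_
    simp only [Function.comp_def]
    have hc : cos φ ^ 2 = 1 - sin φ ^ 2 := by linarith [sin_sq_add_cos_sq φ]
    generalize √(1 - (r * sin φ) ^ 2) = s at *
    rw [← hsq]
    generalize arcsin (r * sin φ) = α at *
    have hr2 := hr'.ne'
    field_simp
    linear_combination (r * s + sin φ * α) * hsq - (r * s + r ^ 2 * sin φ * α) * hc
  · exact ((continuous_comp_mul_sin continuousOn_deriv_mul_arcsin_div_sqrt hr).mul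
      continuous_sin).intervalIntegrable _ _

lemma integral_mul_arcsin_div_sqrt_comp_mul_sin {r : ℝ} (h0 : 0 < r) (h1 : r < 1) :
    ∫ φ in (0 : ℝ)..(π / 2), r * sin φ * (arcsin (r * sin φ) / √(1 - (r * sin φ) ^ 2)) =
      -(π / 4) * log (1 - r ^ 2) := by
  have hd : ∀ x, |x| < 1 → HasDerivAt (fun r => (∫ φ in (0 : ℝ)..(π / 2),
      r * sin φ * (arcsin (r * sin φ) / √(1 - (r * sin φ) ^ 2))) + π / 4 * log (1 - r ^ 2))
      0 x := by
    intro x hx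
    have hx' := one_sub_sq_pos_of_abs_lt_one hx
    have h := hasDerivAt_integral_comp_mul_sin (fun _ h => hasDerivAt_mul_arcsin_div_sqrt h)
      continuousOn_deriv_mul_arcsin_div_sqrt 0 (π / 2) hx
    rw [integral_deriv_mul_arcsin_div_sqrt_comp_mul_sin hx] at h
    refine (h.add ((((hasDerivAt_pow 2 x).const_sub 1).log hx'.ne').const_mul (π / 4))).congr_deriv ?_
    field_simp
    norm_num
    ring
  have habs : ∀ x ∈ Set.Icc 0 r, |x| < 1 := fun x hx => by
    rw [abs_of_nonneg hx.1]; exact hx.2.trans_lt h1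
  obtain ⟨c, -, hc⟩ := exists_hasDerivAt_eq_slope _ (fun _ => 0) h0
    (fun x hx => (hd x (habs x hx)).continuousAt.continuousWithinAt)
    (fun x hx => hd x (habs x (Set.Ioo_subset_Icc_self hx)))
  rw [eq_comm, div_eq_zero_iff] at hc
  rcases hc with hc | hc
  · simp at hc
    simp
    linarith
  · linarith

lemma hasDerivAt_integral_arcsin_sq_half_comp_mul_sin {r : ℝ} (h0 : 0 < r) (h1 : r < 1) :
    HasDerivAt (fun r => ∫ φ in (0 : ℝ)..(π / 2), arcsin (r * sin φ) ^ 2 / 2)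
      (-(π / 4) * log (1 - r ^ 2) / r) r := by
  have hr : |r| < 1 := by rwa [abs_of_pos h0]
  convert hasDerivAt_integral_comp_mul_sin (fun _ h => hasDerivAt_arcsin_sq_half h)
    continuousOn_arcsin_div_sqrt 0 (π / 2) hr using 1
  rw [← integral_mul_arcsin_div_sqrt_comp_mul_sin h0 h1, div_eq_iff h0.ne',
    ← intervalIntegral.integral_mul_const]
  congr 1
  ext φ
  ring

lemma hasDerivAt_integral_arcsin_sq_half_comp_sqrt_mul_sin {x : ℝ} (h0 : 0 < x) (h1 : x < 1) :
    HasDerivAt (fun x => ∫ φ in (0 : ℝ)..(π / 2), arcsin (√x * sin φ) ^ 2 / 2)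
      (-(π / 8) * log (1 - x) / x) x := by
  have hs := sqrt_pos.2 h0
  have hs1 : √x < 1 := by rwa [sqrt_lt' one_pos, one_pow]
  refine ((hasDerivAt_integral_arcsin_sq_half_comp_mul_sin hs hs1).comp x
    (hasDerivAt_sqrt h0.ne')).congr_deriv ?_
  have hsq := sq_sqrt h0.le
  rw [hsq]
  nth_rewrite 2 [← hsq]
  field_simp
  norm_num
  linear_combination (-8) * log (1 - x) * hsq

lemma continuous_integral_arcsin_sq_half_comp_sqrt_mul_sin :
    Continuous fun x => ∫ φ in (0 : ℝ)..(π / 2), arcsin (√x * sin φ) ^ 2 / 2 :=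
  intervalIntegral.continuous_parametric_intervalIntegral_of_continuous'
    (by
      have := continuous_arcsin
      unfold Function.uncurry
      fun_prop) _ _

lemma continuousAt_log_mul_log_one_sub_zero :
    ContinuousAt (fun x => log x * log (1 - x)) 0 := by
  have hd : DifferentiableAt ℝ (fun x => log (1 - x)) 0 := by
    refine DifferentiableAt.log (by fun_prop) (by norm_num)
  have h := continuous_mul_log.continuousAt.mul (continuousAt_dslope_same.2 hd)
  convert h using 1
  ext x
  have := sub_smul_dslope (fun x : ℝ => log (1 - x)) 0 x
  simp at this
  simp only [Pi.mul_apply]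
  rw [← this]
  ring

lemma integral_arcsin_sq_half_comp_sin :
    ∫ φ in (0 : ℝ)..(π / 2), arcsin (sin φ) ^ 2 / 2 = π ^ 3 / 48 := by
  rw [intervalIntegral.integral_congr (g := fun φ => φ ^ 2 / 2)]
  · simp
    ring
  · intro φ hφ
    rw [Set.uIcc_of_le (by positivity)] at hφ
    simp only
    rw [arcsin_sin (by linarith [hφ.1, pi_pos]) hφ.2]

/-- The reflection formula for the dilogarithm, evaluated at `1 / 2`. -/
lemma integral_arcsin_sq_half_comp_sqrt_half_mul_sin :
    ∫ φ in (0 : ℝ)..(π / 2), arcsin (√(1 / 2) * sin φ) ^ 2 / 2 =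
      π ^ 3 / 96 - π / 16 * log 2 ^ 2 := by
  set J : ℝ → ℝ := fun x => ∫ φ in (0 : ℝ)..(π / 2), arcsin (√x * sin φ) ^ 2 / 2 with hJ
  have hJc : Continuous J := continuous_integral_arcsin_sq_half_comp_sqrt_mul_sin
  have hJ1 : J 1 = π ^ 3 / 48 := by
    simpa [hJ] using integral_arcsin_sq_half_comp_sin
  have hJ0 : J 0 = 0 := by simp [hJ]
  have hd : ∀ x ∈ Set.Ioo (0 : ℝ) (1 / 2),
      HasDerivAt (fun x => J x + J (1 - x) + π / 8 * (log x * log (1 - x))) 0 x := by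
    rintro x ⟨h0, h1⟩
    have hx : 0 < 1 - x := by linarith
    have e1 := hasDerivAt_integral_arcsin_sq_half_comp_sqrt_mul_sin h0 (by linarith)
    have hsub := (hasDerivAt_id x).const_sub 1
    have e2 := (hasDerivAt_integral_arcsin_sq_half_comp_sqrt_mul_sin hx (by linarith)).comp x hsub
    have e3 := ((hasDerivAt_log h0.ne').mul (hsub.log hx.ne')).const_mul (π / 8)
    refine ((e1.add e2).add e3).congr_deriv ?_
    simp only [id, sub_sub_cancel]
    field_simp
    ring
  have hc : ContinuousOn (fun x => J x + J (1 - x) + π / 8 * (log x * log (1 - x)))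
      (Set.Icc 0 (1 / 2)) := by
    refine ContinuousOn.add (by fun_prop) (continuousOn_const.mul fun x hx => ?_)
    apply ContinuousAt.continuousWithinAt
    rcases hx.1.eq_or_lt with rfl | h0
    · exact continuousAt_log_mul_log_one_sub_zero
    · have : 1 - x ≠ 0 := by linarith [hx.2]
      have := h0.ne'
      fun_prop (disch := assumption)
  obtain ⟨c, -, h⟩ := exists_hasDerivAt_eq_slope _ (fun _ => 0) (by norm_num) hc hd
  have hl : log (1 / 2) = -log 2 := by rw [one_div, log_inv]
  norm_num [hJ0, hJ1] at h
  norm_num at hl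
  rw [hl] at h
  change J (1 / 2) = _
  linarith

/-- Substitution `t = r * sin φ` followed by integration by parts. -/
lemma integral_arccos_mul_arcsin_div_sqrt {r : ℝ} (h0 : 0 < r) (h1 : r < 1) :
    ∫ t in (0 : ℝ)..r, arccos (t / r) * arcsin t / √(1 - t ^ 2) =
      ∫ φ in (0 : ℝ)..(π / 2), arcsin (r * sin φ) ^ 2 / 2 := by
  have hr : |r| < 1 := by rwa [abs_of_pos h0]
  have hsub := intervalIntegral.integral_comp_mul_deriv'' (a := 0) (b := π / 2)
    (f := fun φ => r * sin φ) (f' := fun φ => r * cos φ)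
    (g := fun t => arccos (t / r) * arcsin t / √(1 - t ^ 2)) (by fun_prop)
    (fun φ _ => ((hasDerivAt_sin φ).const_mul r).hasDerivWithinAt) (by fun_prop)
    (by
      rintro _ ⟨φ, _, rfl⟩
      have hx := abs_mul_sin_lt_one hr φ
      have h := (continuousOn_arcsin_div_sqrt.continuousAt
        ((isOpen_lt continuous_abs continuous_const).mem_nhds hx))
      have h' : Continuous fun t => arccos (t / r) := continuous_arccos.comp (by fun_prop)
      simp only [mul_div_assoc]
      exact (h'.continuousAt.mul h).continuousWithinAt)
  simp only [sin_zero, mul_zero, sin_pi_div_two, mul_one] at hsub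
  rw [← hsub]
  have hparts := intervalIntegral.integral_mul_deriv_eq_deriv_mul (a := 0) (b := π / 2)
    (u := fun φ => π / 2 - φ) (u' := fun _ => -1)
    (v := fun φ => arcsin (r * sin φ) ^ 2 / 2)
    (v' := fun φ => arcsin (r * sin φ) / √(1 - (r * sin φ) ^ 2) * (r * cos φ))
    (fun φ _ => (hasDerivAt_id φ).const_sub _)
    (fun φ _ => (hasDerivAt_arcsin_sq_half (abs_mul_sin_lt_one hr φ)).comp φ
      ((hasDerivAt_sin φ).const_mul r))
    intervalIntegrable_const
    (((continuous_comp_mul_sin continuousOn_arcsin_div_sqrt hr).mul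
      (by fun_prop)).intervalIntegrable _ _)
  simp only [sub_self, zero_mul, sin_zero, mul_zero, arcsin_zero, neg_one_mul,
    intervalIntegral.integral_neg] at hparts
  rw [zero_pow two_ne_zero, zero_div, mul_zero, sub_zero, zero_sub, neg_neg] at hparts
  rw [← hparts]
  refine intervalIntegral.integral_congr fun φ hφ => ?_
  rw [Set.uIcc_of_le (by positivity)] at hφ
  have hφ' : arccos (r * sin φ / r) = π / 2 - φ := by
    rw [mul_div_cancel_left₀ _ h0.ne', arccos_eq_pi_div_two_sub_arcsin,
      arcsin_sin (by linarith [hφ.1, pi_pos]) hφ.2]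
  simp only [Function.comp_apply, hφ']
  ring

theorem karamata_special_value :
    16 / π ^ 3 * ∫ t in (0 : ℝ)..(1 / Real.sqrt 2),
        Real.arccos (t * Real.sqrt 2) * Real.arcsin t / Real.sqrt (1 - t ^ 2) =
      1 / 6 - (Real.log 2 / π) ^ 2 := by
  have h0 : (0 : ℝ) < 1 / √2 := by positivity
  have h1 : 1 / √2 < 1 := by
    rw [div_lt_one (by positivity)]
    exact one_lt_sqrt_two
  have h := integral_arccos_mul_arcsin_div_sqrt h0 h1
  have hs : √(1 / 2) = 1 / √2 := by simp
  rw [← hs, integral_arcsin_sq_half_comp_sqrt_half_mul_sin, hs] at h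
  simp only [div_div_eq_mul_div, div_one] at h
  rw [h]
  field_simp
  ring
end
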